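/- For every a > 0 and every z₀ ∈ ℝ³: ∫_{ℝ³} ∫_{ℝ³} [ e^{−a(|z₀−z₁| + |z₁−z₂| + |z₂−z₀|)} / ( |z₀−z₁|·|z₁−z₂|·|z₂−z₀| ) ] dz₁ dz₂ = 2π²/a³. Equivalently, for h > 0 and c > 0, taking a = h^{−1}√(2c), the double integral equals √π · (2π)^{3/2} · h³ / (4 c^{3/2}). -/

import Mathlib

open MeasureTheory Real

/-- The heat kernel in three dimensions (as a function of the distance) with mass damping. -/
noncomputable def heatK (a t r : ℝ) : ℝ :=
  Real.exp (-(a ^ 2 * t) - r ^ 2 / (4 * t)) / (√(4 * π * t)) ^ 3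

noncomputable def gaussPrim (x : ℝ) : ℝ := ∫ t in (0 : ℝ)..x, Real.exp (-t ^ 2)

lemma hasDerivAt_gaussPrim (x : ℝ) : HasDerivAt gaussPrim (Real.exp (-x ^ 2)) x := by
  have hc : Continuous fun t : ℝ => Real.exp (-t ^ 2) := by fun_prop
  exact intervalIntegral.integral_hasDerivAt_right (hc.intervalIntegrable _ _)
    hc.aestronglyMeasurable.stronglyMeasurableAtFilter hc.continuousAt

lemma tendsto_gaussPrim_atTop :
    Filter.Tendsto gaussPrim Filter.atTop (nhds (√π / 2)) := by
  have h1 := integral_gaussian_Ioi 1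
  have hi : IntegrableOn (fun x : ℝ => Real.exp (-x ^ 2)) (Set.Ioi 0) := by
    have := (integrable_exp_neg_mul_sq (b := 1) one_pos).integrableOn (s := Set.Ioi 0)
    simpa using this
  have h := intervalIntegral_tendsto_integral_Ioi 0 hi Filter.tendsto_id
  simp only [neg_mul, one_mul, div_one] at h1
  rw [h1] at h
  exact h

lemma gaussPrim_neg (x : ℝ) : gaussPrim (-x) = - gaussPrim x := by
  unfold gaussPrim
  have := intervalIntegral.integral_comp_neg (a := 0) (b := x) (fun t : ℝ => Real.exp (-t ^ 2))
  simp only [neg_sq, neg_zero] at this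
  rw [this, intervalIntegral.integral_symm]

lemma tendsto_gaussPrim_atBot :
    Filter.Tendsto gaussPrim Filter.atBot (nhds (-(√π / 2))) := by
  have := (tendsto_gaussPrim_atTop.comp Filter.tendsto_neg_atBot_atTop).neg
  refine this.congr fun x => ?_
  simp [gaussPrim_neg]

lemma heat_integral {a r : ℝ} (ha : 0 < a) (hr : 0 < r) :
    ∫ t in Set.Ioi (0 : ℝ), heatK a t r = Real.exp (-(a * r)) / (4 * π * r) := by
  let F : ℝ → ℝ := fun t => -(2 / r) / (√(4 * π)) ^ 3 *
    (Real.exp (a * r) * gaussPrim (r / (2 * √t) + a * √t) +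
      Real.exp (-(a * r)) * gaussPrim (r / (2 * √t) - a * √t))
  let L : ℝ := -(2 / r) / (√(4 * π)) ^ 3 *
    (Real.exp (a * r) * (√π / 2) + Real.exp (-(a * r)) * (√π / 2))
  let M : ℝ := -(2 / r) / (√(4 * π)) ^ 3 *
    (Real.exp (a * r) * (√π / 2) + Real.exp (-(a * r)) * (-(√π / 2)))
  have hs0 : Filter.Tendsto (fun t : ℝ => √t) (nhdsWithin 0 (Set.Ioi 0)) (nhdsWithin 0 (Set.Ioi 0)) := by
    refine tendsto_nhdsWithin_iff.2 ⟨?_, ?_⟩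
    · have := (Real.continuous_sqrt.tendsto 0).mono_left (nhdsWithin_le_nhds (s := Set.Ioi 0))
      simpa using this
    · filter_upwards [self_mem_nhdsWithin] with t ht
      exact Real.sqrt_pos.2 ht
  have hinv0 : Filter.Tendsto (fun t : ℝ => r / (2 * √t)) (nhdsWithin 0 (Set.Ioi 0)) Filter.atTop := by
    have := (tendsto_inv_nhdsGT_zero.comp hs0).const_mul_atTop (half_pos hr)
    refine this.congr fun t => ?_
    simp [div_eq_mul_inv]; ring
  have has0 : Filter.Tendsto (fun t : ℝ => a * √t) (nhdsWithin 0 (Set.Ioi 0)) (nhds 0) := by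
    have := (tendsto_nhdsWithin_iff.1 hs0).1.const_mul a
    simpa using this
  have hF0 : Filter.Tendsto F (nhdsWithin 0 (Set.Ioi 0)) (nhds L) := by
    refine Filter.Tendsto.const_mul _ (Filter.Tendsto.add ?_ ?_)
    · exact (tendsto_gaussPrim_atTop.comp (hinv0.atTop_add has0)).const_mul _
    · refine (tendsto_gaussPrim_atTop.comp ?_).const_mul _
      simpa [sub_eq_add_neg] using hinv0.atTop_add has0.neg
  have hst : Filter.Tendsto (fun t : ℝ => a * √t) Filter.atTop Filter.atTop :=
    Real.tendsto_sqrt_atTop.const_mul_atTop ha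
  have hit : Filter.Tendsto (fun t : ℝ => r / (2 * √t)) Filter.atTop (nhds 0) := by
    exact (Real.tendsto_sqrt_atTop.const_mul_atTop two_pos).const_div_atTop r
  have hFt : Filter.Tendsto F Filter.atTop (nhds M) := by
    refine Filter.Tendsto.const_mul _ (Filter.Tendsto.add ?_ ?_)
    · exact (tendsto_gaussPrim_atTop.comp (hit.add_atTop hst)).const_mul _
    · refine (tendsto_gaussPrim_atBot.comp ?_).const_mul _
      simpa [sub_eq_add_neg] using hit.add_atBot (Filter.tendsto_neg_atTop_atBot.comp hst)
  have hderiv : ∀ t ∈ Set.Ioi (0 : ℝ), HasDerivAt F (heatK a t r) t := by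
    intro t ht
    have ht : 0 < t := ht
    have hq : 0 < √t := Real.sqrt_pos.2 ht
    have hqq : √t ^ 2 = t := Real.sq_sqrt ht.le
    have h1 : HasDerivAt (fun t : ℝ => √t) (1 / (2 * √t)) t := Real.hasDerivAt_sqrt ht.ne'
    have h2 : HasDerivAt (fun t : ℝ => a * √t) (a * (1 / (2 * √t))) t := h1.const_mul a
    have h3 : HasDerivAt (fun t : ℝ => r / (2 * √t)) (-(r / (4 * √t ^ 3))) t := by
      have := ((h1.const_mul 2).inv (by positivity)).const_mul r
      refine HasDerivAt.congr_deriv this ?_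
      field_simp
      norm_num
    have e1 : Real.exp (a * r) * Real.exp (-(r / (2 * √t) + a * √t) ^ 2)
        = Real.exp (-(a ^ 2 * t) - r ^ 2 / (4 * t)) := by
      rw [← Real.exp_add]; congr 1
      have h5 : r ^ 2 / (4 * t) = r ^ 2 / (4 * √t ^ 2) := by rw [hqq]
      have h6 : a ^ 2 * t = a ^ 2 * √t ^ 2 := by rw [hqq]
      rw [h5, h6]
      field_simp; ring
    have e2 : Real.exp (-(a * r)) * Real.exp (-(r / (2 * √t) - a * √t) ^ 2)
        = Real.exp (-(a ^ 2 * t) - r ^ 2 / (4 * t)) := by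
      rw [← Real.exp_add]; congr 1
      have h5 : r ^ 2 / (4 * t) = r ^ 2 / (4 * √t ^ 2) := by rw [hqq]
      have h6 : a ^ 2 * t = a ^ 2 * √t ^ 2 := by rw [hqq]
      rw [h5, h6]
      field_simp; ring
    have hA := (((hasDerivAt_gaussPrim _).comp t (h3.add h2)).const_mul (Real.exp (a * r)))
    have hB := (((hasDerivAt_gaussPrim _).comp t (h3.sub h2)).const_mul (Real.exp (-(a * r))))
    have := (hA.add hB).const_mul (-(2 / r) / (√(4 * π)) ^ 3)
    refine HasDerivAt.congr_deriv this ?_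
    simp only [Pi.add_apply, Pi.sub_apply, ← mul_assoc, e1, e2]
    unfold heatK
    rw [Real.sqrt_mul (by positivity) t]
    have : 0 < √(4 * π) := by positivity
    field_simp
    ring
  have hderiv' : ∀ t ∈ Set.Ioi (0 : ℝ), HasDerivAt (Function.update F 0 L) (heatK a t r) t := by
    intro t ht
    refine (hderiv t ht).congr_of_eventuallyEq ?_
    filter_upwards [Ioi_mem_nhds ht] with s hs
    rw [Function.update_of_ne (ne_of_gt hs)]
  have key := integral_Ioi_of_hasDerivAt_of_nonneg (g := Function.update F 0 L) (a := 0) (l := M)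
    (g' := fun t => heatK a t r) ?_ hderiv' ?_ ?_
  · rw [key, Function.update_self]
    have h4 : √(4 * π) = 2 * √π := by
      rw [Real.sqrt_mul (by norm_num), show (4 : ℝ) = 2 ^ 2 by norm_num, Real.sqrt_sq (by norm_num)]
    have hp : √π ^ 2 = π := Real.sq_sqrt pi_pos.le
    have hp0 : 0 < √π := by positivity
    simp only [L, M, h4]
    have h7 : Real.exp (-(a * r)) / (4 * π * r) = Real.exp (-(a * r)) / (4 * √π ^ 2 * r) := by
      rw [hp]
    rw [h7]
    field_simp
    ring
  · rw [continuousWithinAt_update_same, Set.Ici_sdiff_left]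
    exact hF0
  · intro t ht
    unfold heatK; positivity
  · refine hFt.congr' ?_
    filter_upwards [Filter.eventually_gt_atTop 0] with s hs
    rw [Function.update_of_ne (ne_of_gt hs)]

lemma heatK_nonneg (a t r : ℝ) : 0 ≤ heatK a t r := by
  unfold heatK; positivity

lemma lintegral_of_integral_pos {α : Type*} [MeasurableSpace α] {μ : Measure α} {f : α → ℝ} {c : ℝ}
    (hf : ∀ x, 0 ≤ f x) (h : ∫ x, f x ∂μ = c) (hc : 0 < c) :
    ∫⁻ x, ENNReal.ofReal (f x) ∂μ = ENNReal.ofReal c := by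
  have hi : Integrable f μ := Integrable.of_integral_ne_zero (by rw [h]; exact hc.ne')
  rw [← ofReal_integral_eq_lintegral_ofReal hi (Filter.Eventually.of_forall hf), h]

lemma heat_square {s t : ℝ} (hs : 0 < s) (ht : 0 < t) (x y z : EuclideanSpace ℝ (Fin 3)) :
    ‖x - z‖ ^ 2 / (4 * s) + ‖z - y‖ ^ 2 / (4 * t) =
      (s + t) / (4 * s * t) * ‖z - ((t / (s + t)) • x + (s / (s + t)) • y)‖ ^ 2 +
        ‖x - y‖ ^ 2 / (4 * (s + t)) := by
  simp only [EuclideanSpace.real_norm_sq_eq, Fin.sum_univ_three, PiLp.sub_apply, PiLp.add_apply,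
    PiLp.smul_apply, smul_eq_mul]
  have : s + t ≠ 0 := by positivity
  field_simp
  ring

lemma heat_conv_real {a s t : ℝ} (hs : 0 < s) (ht : 0 < t) (x y : EuclideanSpace ℝ (Fin 3)) :
    ∫ z : EuclideanSpace ℝ (Fin 3), heatK a s ‖x - z‖ * heatK a t ‖z - y‖ =
      heatK a (s + t) ‖x - y‖ := by
  have hst : 0 < s + t := by positivity
  have hb : 0 < (s + t) / (4 * s * t) := by positivity
  have hg := GaussianFourier.integral_rexp_neg_mul_sq_norm (V := EuclideanSpace ℝ (Fin 3)) hb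
  rw [← integral_sub_right_eq_self _ ((t / (s + t)) • x + (s / (s + t)) • y)] at hg
  have hfun : ∀ z : EuclideanSpace ℝ (Fin 3), heatK a s ‖x - z‖ * heatK a t ‖z - y‖ =
      (heatK a (s + t) ‖x - y‖ * (√(4 * π * (s + t))) ^ 3 /
        ((√(4 * π * s)) ^ 3 * (√(4 * π * t)) ^ 3)) *
      Real.exp (-((s + t) / (4 * s * t)) *
        ‖z - ((t / (s + t)) • x + (s / (s + t)) • y)‖ ^ 2) := by
    intro z
    have hsq := heat_square hs ht x y z
    have he : Real.exp (-(a ^ 2 * s) - ‖x - z‖ ^ 2 / (4 * s)) *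
        Real.exp (-(a ^ 2 * t) - ‖z - y‖ ^ 2 / (4 * t)) =
        Real.exp (-(a ^ 2 * (s + t)) - ‖x - y‖ ^ 2 / (4 * (s + t))) *
        Real.exp (-((s + t) / (4 * s * t)) *
        ‖z - ((t / (s + t)) • x + (s / (s + t)) • y)‖ ^ 2) := by
      rw [← Real.exp_add, ← Real.exp_add]; congr 1; linarith
    unfold heatK
    rw [div_mul_div_comm, he]
    have : 0 < √(4 * π * (s + t)) := by positivity
    field_simp
  simp_rw [hfun]
  rw [integral_const_mul, hg]
  have hpow : (π / ((s + t) / (4 * s * t))) ^ ((Module.finrank ℝ (EuclideanSpace ℝ (Fin 3)) : ℝ) / 2)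
      = (√(4 * π * s) * √(4 * π * t) / √(4 * π * (s + t))) ^ 3 := by
    rw [← Real.sqrt_mul (by positivity), ← Real.sqrt_div (by positivity), Real.sqrt_eq_rpow,
      ← Real.rpow_natCast, ← Real.rpow_mul (by positivity)]
    simp only [finrank_euclideanSpace, Fintype.card_fin]
    congr 1
    · field_simp
    · norm_num
  rw [hpow]
  have h1 : 0 < √(4 * π * (s + t)) := by positivity
  have h2 : 0 < √(4 * π * s) := by positivity
  have h3 : 0 < √(4 * π * t) := by positivity
  field_simp

lemma heat_conv {a s t : ℝ} (hs : 0 < s) (ht : 0 < t) (x y : EuclideanSpace ℝ (Fin 3)) :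
    ∫⁻ z : EuclideanSpace ℝ (Fin 3),
      ENNReal.ofReal (heatK a s ‖x - z‖) * ENNReal.ofReal (heatK a t ‖z - y‖) =
      ENNReal.ofReal (heatK a (s + t) ‖x - y‖) := by
  simp_rw [← ENNReal.ofReal_mul (heatK_nonneg _ _ _)]
  refine lintegral_of_integral_pos (fun z => mul_nonneg (heatK_nonneg _ _ _) (heatK_nonneg _ _ _))
    (heat_conv_real hs ht x y) ?_
  unfold heatK; positivity

lemma lintegral_add_Ioi (φ f : ℝ → ENNReal) (hφ : Measurable φ) (hf : Measurable f) :
    ∫⁻ s in Set.Ioi (0 : ℝ), ∫⁻ t in Set.Ioi (0 : ℝ), φ t * f (s + t) =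
      ∫⁻ u in Set.Ioi (0 : ℝ), (∫⁻ t in Set.Ioo (0 : ℝ) u, φ t) * f u := by
  rw [lintegral_lintegral_swap (by fun_prop)]
  have h1 : ∀ t : ℝ, ∫⁻ s in Set.Ioi (0 : ℝ), φ t * f (s + t) =
      ∫⁻ u, (Set.Ioi t).indicator (fun u => φ t * f u) u := by
    intro t
    rw [← lintegral_indicator measurableSet_Ioi,
      ← lintegral_add_right_eq_self (fun u => (Set.Ioi t).indicator (fun u => φ t * f u) u) t]
    congr 1; ext s
    simp [Set.indicator_apply]
  simp_rw [h1]
  rw [← lintegral_indicator measurableSet_Ioi, ← lintegral_indicator measurableSet_Ioi]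
  have h2 : ∀ t : ℝ, (Set.Ioi (0:ℝ)).indicator
      (fun t => ∫⁻ u, (Set.Ioi t).indicator (fun u => φ t * f u) u) t =
      ∫⁻ u, {p : ℝ × ℝ | 0 < p.1 ∧ p.1 < p.2}.indicator (fun p => φ p.1 * f p.2) (t, u) := by
    intro t
    by_cases ht : 0 < t <;> simp [Set.indicator_apply, ht]
  have hm : MeasurableSet {p : ℝ × ℝ | 0 < p.1 ∧ p.1 < p.2} :=
    (measurableSet_lt measurable_const measurable_fst).inter
      (measurableSet_lt measurable_fst measurable_snd)
  have hM : Measurable ({p : ℝ × ℝ | 0 < p.1 ∧ p.1 < p.2}.indicator (fun p => φ p.1 * f p.2)) :=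
    Measurable.indicator (by fun_prop) hm
  simp_rw [h2]
  rw [lintegral_lintegral_swap (f := fun t u =>
    {p : ℝ × ℝ | 0 < p.1 ∧ p.1 < p.2}.indicator (fun p => φ p.1 * f p.2) (t, u)) hM.aemeasurable]
  congr 1; ext u
  by_cases hu : 0 < u
  · simp only [Set.indicator_apply, Set.mem_Ioi, hu, if_true]
    rw [← lintegral_mul_const _ hφ, ← lintegral_indicator measurableSet_Ioo]
    congr 1; ext t
    simp [Set.indicator_apply]
  · simp only [Set.indicator_apply, Set.mem_Ioi, hu, if_false]
    have hz : ∀ t : ℝ, ¬ (0 < t ∧ t < u) := fun t h => hu (h.1.trans h.2)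
    simp only [Set.mem_ofPred_eq, hz, if_false, lintegral_zero]

lemma measurable_heatK_comp (a : ℝ) {α : Type*} [MeasurableSpace α] {f g : α → ℝ}
    (hf : Measurable f) (hg : Measurable g) :
    Measurable fun p => ENNReal.ofReal (heatK a (f p) (g p)) := by
  unfold heatK; fun_prop

lemma heat_conv_weighted (a : ℝ) (φ : ℝ → ENNReal) (hφ : Measurable φ)
    (x y : EuclideanSpace ℝ (Fin 3)) :
    ∫⁻ z : EuclideanSpace ℝ (Fin 3),
      (∫⁻ s in Set.Ioi (0 : ℝ), ENNReal.ofReal (heatK a s ‖x - z‖)) *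
      (∫⁻ t in Set.Ioi (0 : ℝ), φ t * ENNReal.ofReal (heatK a t ‖z - y‖)) =
    ∫⁻ u in Set.Ioi (0 : ℝ), (∫⁻ t in Set.Ioo (0 : ℝ) u, φ t) *
      ENNReal.ofReal (heatK a u ‖x - y‖) := by
  have hK1 : Measurable fun p : EuclideanSpace ℝ (Fin 3) × ℝ =>
      ENNReal.ofReal (heatK a p.2 ‖x - p.1‖) := measurable_heatK_comp a (by fun_prop) (by fun_prop)
  have hK2 : Measurable fun p : EuclideanSpace ℝ (Fin 3) × ℝ =>
      φ p.2 * ENNReal.ofReal (heatK a p.2 ‖p.1 - y‖) :=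
    (hφ.comp measurable_snd).mul (measurable_heatK_comp a (by fun_prop) (by fun_prop))
  have hG2 : Measurable fun z : EuclideanSpace ℝ (Fin 3) =>
      ∫⁻ t in Set.Ioi (0 : ℝ), φ t * ENNReal.ofReal (heatK a t ‖z - y‖) :=
    hK2.lintegral_prod_right'
  have hs1 : ∀ z, Measurable fun s => ENNReal.ofReal (heatK a s ‖x - z‖) := fun z =>
    measurable_heatK_comp a (by fun_prop) (by fun_prop)
  have hs2 : ∀ z, Measurable fun t => φ t * ENNReal.ofReal (heatK a t ‖z - y‖) := fun z =>
    hφ.mul (measurable_heatK_comp a (by fun_prop) (by fun_prop))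
  have step1 : ∀ z : EuclideanSpace ℝ (Fin 3),
      (∫⁻ s in Set.Ioi (0 : ℝ), ENNReal.ofReal (heatK a s ‖x - z‖)) *
      (∫⁻ t in Set.Ioi (0 : ℝ), φ t * ENNReal.ofReal (heatK a t ‖z - y‖)) =
      ∫⁻ s in Set.Ioi (0 : ℝ), ENNReal.ofReal (heatK a s ‖x - z‖) *
      (∫⁻ t in Set.Ioi (0 : ℝ), φ t * ENNReal.ofReal (heatK a t ‖z - y‖)) := fun z =>
    (lintegral_mul_const _ (hs1 z)).symm
  simp_rw [step1]
  rw [lintegral_lintegral_swap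
    (f := fun z s => ENNReal.ofReal (heatK a s ‖x - z‖) *
      (∫⁻ t in Set.Ioi (0 : ℝ), φ t * ENNReal.ofReal (heatK a t ‖z - y‖)))
    (hK1.mul (hG2.comp measurable_fst)).aemeasurable]
  rw [← lintegral_add_Ioi φ (fun u => ENNReal.ofReal (heatK a u ‖x - y‖)) hφ
    (measurable_heatK_comp a (by fun_prop) (by fun_prop))]
  refine setLIntegral_congr_fun measurableSet_Ioi fun s hs => ?_
  have step2 : ∀ z : EuclideanSpace ℝ (Fin 3), ENNReal.ofReal (heatK a s ‖x - z‖) *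
      (∫⁻ t in Set.Ioi (0 : ℝ), φ t * ENNReal.ofReal (heatK a t ‖z - y‖)) =
      ∫⁻ t in Set.Ioi (0 : ℝ), ENNReal.ofReal (heatK a s ‖x - z‖) *
        (φ t * ENNReal.ofReal (heatK a t ‖z - y‖)) := fun z =>
    (lintegral_const_mul _ (hs2 z)).symm
  simp_rw [step2]
  have hm1 : Measurable fun z : EuclideanSpace ℝ (Fin 3) =>
      ENNReal.ofReal (heatK a s ‖x - z‖) := measurable_heatK_comp a (by fun_prop) (by fun_prop)
  rw [lintegral_lintegral_swap
    (f := fun z t => ENNReal.ofReal (heatK a s ‖x - z‖) *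
        (φ t * ENNReal.ofReal (heatK a t ‖z - y‖)))
    ((hm1.comp measurable_fst).mul hK2).aemeasurable]
  refine setLIntegral_congr_fun measurableSet_Ioi fun t ht => ?_
  have hm2 : Measurable fun z : EuclideanSpace ℝ (Fin 3) =>
      ENNReal.ofReal (heatK a t ‖z - y‖) := measurable_heatK_comp a (by fun_prop) (by fun_prop)
  rw [← heat_conv hs ht x y, ← lintegral_const_mul _ (by fun_prop)]
  congr 1; ext z; ring

lemma lintegral_Ioo_ofReal {u : ℝ} (hu : 0 < u) :
    ∫⁻ t in Set.Ioo (0 : ℝ) u, ENNReal.ofReal t = ENNReal.ofReal (u ^ 2 / 2) := by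
  rw [← ofReal_integral_eq_lintegral_ofReal]
  · rw [← integral_Ioc_eq_integral_Ioo, ← intervalIntegral.integral_of_le hu.le]
    simp
  · exact (continuous_id.integrableOn_Icc).mono_set Set.Ioo_subset_Icc_self
  · filter_upwards [ae_restrict_mem measurableSet_Ioo] with t ht
    exact ht.1.le

lemma heat_final {a : ℝ} (ha : 0 < a) :
    ∫⁻ u in Set.Ioi (0 : ℝ), ENNReal.ofReal (u ^ 2 / 2) * ENNReal.ofReal (heatK a u 0) =
      ENNReal.ofReal (1 / (32 * π * a ^ 3)) := by
  have h := Real.integral_rpow_mul_exp_neg_mul_Ioi (a := 3 / 2) (r := a ^ 2) (by norm_num)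
    (by positivity)
  have hmul : ∀ u : ℝ, ENNReal.ofReal (u ^ 2 / 2) * ENNReal.ofReal (heatK a u 0) =
      ENNReal.ofReal (u ^ 2 / 2 * heatK a u 0) := fun u =>
    (ENNReal.ofReal_mul (by positivity)).symm
  simp_rw [hmul]
  refine lintegral_of_integral_pos (fun u => mul_nonneg (by positivity) (heatK_nonneg _ _ _)) ?_
    (by positivity)
  have hfun : Set.EqOn (fun u : ℝ => u ^ 2 / 2 * heatK a u 0)
      (fun u => 1 / (2 * √(4 * π) ^ 3) * (u ^ ((3 : ℝ) / 2 - 1) * Real.exp (-(a ^ 2 * u))))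
      (Set.Ioi 0) := by
    intro u hu
    have hu : 0 < u := hu
    have h1 : u ^ ((3 : ℝ) / 2 - 1) = √u := by rw [Real.sqrt_eq_rpow]; norm_num
    have h2 : u ^ 2 = √u ^ 4 := by
      rw [show √u ^ 4 = (√u ^ 2) ^ 2 by ring, Real.sq_sqrt hu.le]
    have h3 : 0 < √u := Real.sqrt_pos.2 hu
    simp only [heatK, h1]
    rw [Real.sqrt_mul (by positivity) u, h2]
    simp only [ne_eq, OfNat.ofNat_ne_zero, not_false_eq_true, zero_pow, zero_div, sub_zero]
    field_simp
  rw [setIntegral_congr_fun measurableSet_Ioi hfun, integral_const_mul, h]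
  have hG : Real.Gamma (3 / 2) = √π / 2 := by
    rw [show (3 : ℝ) / 2 = 1 / 2 + 1 by norm_num, Real.Gamma_add_one (by norm_num),
      Real.Gamma_one_half_eq]; ring
  have hA : (1 / a ^ 2) ^ ((3 : ℝ) / 2) = 1 / a ^ 3 := by
    rw [show (1 / a ^ 2) = (1 / a) ^ (2 : ℝ) by
      rw [show (2 : ℝ) = ((2 : ℕ) : ℝ) by norm_num, Real.rpow_natCast]; ring]
    rw [← Real.rpow_mul (by positivity), show (2 : ℝ) * (3 / 2) = ((3 : ℕ) : ℝ) by norm_num,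
      Real.rpow_natCast]; ring
  have h4 : √(4 * π) = 2 * √π := by
    rw [Real.sqrt_mul (by norm_num), show (4 : ℝ) = 2 ^ 2 by norm_num, Real.sqrt_sq (by norm_num)]
  have hp : √π ^ 2 = π := Real.sq_sqrt pi_pos.le
  have hp0 : 0 < √π := by positivity
  rw [hG, hA, h4]
  have h7 : 1 / (32 * π * a ^ 3) = 1 / (32 * √π ^ 2 * a ^ 3) := by rw [hp]
  rw [h7]
  field_simp
  norm_num

/-- The Yukawa kernel. -/
noncomputable def yuk (a r : ℝ) : ℝ := Real.exp (-(a * r)) / (4 * π * r)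

lemma yuk_nonneg {a r : ℝ} (hr : 0 ≤ r) : 0 ≤ yuk a r := by unfold yuk; positivity

lemma yuk_eq {a r : ℝ} (ha : 0 < a) (hr : 0 < r) :
    ENNReal.ofReal (yuk a r) = ∫⁻ t in Set.Ioi (0 : ℝ), ENNReal.ofReal (heatK a t r) :=
  (lintegral_of_integral_pos (fun t => heatK_nonneg a t r) (heat_integral ha hr)
    (by positivity)).symm

lemma yuk_lintegral {a : ℝ} (ha : 0 < a) (z₀ : EuclideanSpace ℝ (Fin 3)) :
    ∫⁻ z₁ : EuclideanSpace ℝ (Fin 3), ∫⁻ z₂ : EuclideanSpace ℝ (Fin 3),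
      ENNReal.ofReal (yuk a ‖z₀ - z₁‖ * yuk a ‖z₁ - z₂‖ * yuk a ‖z₂ - z₀‖) =
      ENNReal.ofReal (1 / (32 * π * a ^ 3)) := by
  have inner : ∀ z₁ : EuclideanSpace ℝ (Fin 3), ∫⁻ z₂ : EuclideanSpace ℝ (Fin 3),
      ENNReal.ofReal (yuk a ‖z₀ - z₁‖ * yuk a ‖z₁ - z₂‖ * yuk a ‖z₂ - z₀‖) =
      ENNReal.ofReal (yuk a ‖z₀ - z₁‖) *
        ∫⁻ u in Set.Ioi (0 : ℝ), ENNReal.ofReal u * ENNReal.ofReal (heatK a u ‖z₁ - z₀‖) := by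
    intro z₁
    have h := heat_conv_weighted a (fun _ => 1) measurable_const z₁ z₀
    have h2 : ∫⁻ u in Set.Ioi (0 : ℝ), (∫⁻ t in Set.Ioo (0 : ℝ) u, (1 : ENNReal)) *
        ENNReal.ofReal (heatK a u ‖z₁ - z₀‖) =
        ∫⁻ u in Set.Ioi (0 : ℝ), ENNReal.ofReal u * ENNReal.ofReal (heatK a u ‖z₁ - z₀‖) := by
      refine setLIntegral_congr_fun measurableSet_Ioi fun u hu => ?_
      simp
    rw [h2] at h
    rw [← h, ← lintegral_const_mul' _ _ ENNReal.ofReal_ne_top]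
    refine lintegral_congr_ae ?_
    filter_upwards [Measure.ae_ne volume z₀, Measure.ae_ne volume z₁] with z₂ h0 h1
    have p0 : 0 < ‖z₂ - z₀‖ := norm_pos_iff.2 (sub_ne_zero.2 h0)
    have p1 : 0 < ‖z₁ - z₂‖ := norm_pos_iff.2 (sub_ne_zero.2 h1.symm)
    rw [mul_assoc, ENNReal.ofReal_mul (yuk_nonneg (norm_nonneg _)),
      ENNReal.ofReal_mul (yuk_nonneg (norm_nonneg _)), yuk_eq ha p0, yuk_eq ha p1]
    simp
  simp_rw [inner]
  rw [← heat_final ha]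
  have h := heat_conv_weighted a ENNReal.ofReal ENNReal.measurable_ofReal z₀ z₀
  have h2 : ∫⁻ u in Set.Ioi (0 : ℝ), (∫⁻ t in Set.Ioo (0 : ℝ) u, ENNReal.ofReal t) *
        ENNReal.ofReal (heatK a u ‖z₀ - z₀‖) =
        ∫⁻ u in Set.Ioi (0 : ℝ), ENNReal.ofReal (u ^ 2 / 2) * ENNReal.ofReal (heatK a u 0) := by
    refine setLIntegral_congr_fun measurableSet_Ioi fun u hu => ?_
    simp only [sub_self, norm_zero]
    rw [lintegral_Ioo_ofReal hu]
  rw [← h2, ← h]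
  refine lintegral_congr_ae ?_
  filter_upwards [Measure.ae_ne volume z₀] with z₁ h0
  rw [yuk_eq ha (norm_pos_iff.2 (sub_ne_zero.2 h0.symm))]

lemma yuk_integral {a : ℝ} (ha : 0 < a) (z₀ : EuclideanSpace ℝ (Fin 3)) :
    ∫ z₁ : EuclideanSpace ℝ (Fin 3), ∫ z₂ : EuclideanSpace ℝ (Fin 3),
      yuk a ‖z₀ - z₁‖ * yuk a ‖z₁ - z₂‖ * yuk a ‖z₂ - z₀‖ = 1 / (32 * π * a ^ 3) := by
  have hm : Measurable fun p : EuclideanSpace ℝ (Fin 3) × EuclideanSpace ℝ (Fin 3) =>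
      yuk a ‖z₀ - p.1‖ * yuk a ‖p.1 - p.2‖ * yuk a ‖p.2 - z₀‖ := by
    unfold yuk; fun_prop
  have h1 : ∀ z₁ : EuclideanSpace ℝ (Fin 3), ∫ z₂ : EuclideanSpace ℝ (Fin 3),
      yuk a ‖z₀ - z₁‖ * yuk a ‖z₁ - z₂‖ * yuk a ‖z₂ - z₀‖ =
      (∫⁻ z₂ : EuclideanSpace ℝ (Fin 3),
      ENNReal.ofReal (yuk a ‖z₀ - z₁‖ * yuk a ‖z₁ - z₂‖ * yuk a ‖z₂ - z₀‖)).toReal := by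
    intro z₁
    refine integral_eq_lintegral_of_nonneg_ae (Filter.Eventually.of_forall fun z₂ => ?_)
      (hm.comp (measurable_const.prodMk measurable_id)).aestronglyMeasurable
    have := @yuk_nonneg a
    exact mul_nonneg (mul_nonneg (yuk_nonneg (norm_nonneg _)) (yuk_nonneg (norm_nonneg _)))
      (yuk_nonneg (norm_nonneg _))
  have hM : Measurable fun z₁ : EuclideanSpace ℝ (Fin 3) => ∫⁻ z₂ : EuclideanSpace ℝ (Fin 3),
      ENNReal.ofReal (yuk a ‖z₀ - z₁‖ * yuk a ‖z₁ - z₂‖ * yuk a ‖z₂ - z₀‖) :=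
    (hm.ennreal_ofReal).lintegral_prod_right'
  have hL := yuk_lintegral ha z₀
  simp_rw [h1]
  rw [integral_toReal hM.aemeasurable (ae_lt_top hM (by rw [hL]; exact ENNReal.ofReal_ne_top)), hL,
    ENNReal.toReal_ofReal (by positivity)]

lemma spin_green_aux (a : ℝ) (ha : 0 < a) (z₀ : EuclideanSpace ℝ (Fin 3)) :
      (∫ z₁ : EuclideanSpace ℝ (Fin 3), ∫ z₂ : EuclideanSpace ℝ (Fin 3),
          Real.exp (-a * (‖z₀ - z₁‖ + ‖z₁ - z₂‖ + ‖z₂ - z₀‖)) /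
            (‖z₀ - z₁‖ * ‖z₁ - z₂‖ * ‖z₂ - z₀‖))
        = 2 * Real.pi ^ 2 / a ^ 3 := by
  have hpt : ∀ z₁ z₂ : EuclideanSpace ℝ (Fin 3),
      Real.exp (-a * (‖z₀ - z₁‖ + ‖z₁ - z₂‖ + ‖z₂ - z₀‖)) /
            (‖z₀ - z₁‖ * ‖z₁ - z₂‖ * ‖z₂ - z₀‖) =
      (4 * π) ^ 3 * (yuk a ‖z₀ - z₁‖ * yuk a ‖z₁ - z₂‖ * yuk a ‖z₂ - z₀‖) := by
    intro z₁ z₂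
    have he : Real.exp (-a * (‖z₀ - z₁‖ + ‖z₁ - z₂‖ + ‖z₂ - z₀‖)) =
        Real.exp (-(a * ‖z₀ - z₁‖)) * Real.exp (-(a * ‖z₁ - z₂‖)) *
          Real.exp (-(a * ‖z₂ - z₀‖)) := by
      rw [← Real.exp_add, ← Real.exp_add]; congr 1; ring
    rw [he]
    unfold yuk
    rw [div_mul_div_comm, div_mul_div_comm, show 4 * π * ‖z₀ - z₁‖ * (4 * π * ‖z₁ - z₂‖) *
      (4 * π * ‖z₂ - z₀‖) = (4 * π) ^ 3 * (‖z₀ - z₁‖ * ‖z₁ - z₂‖ * ‖z₂ - z₀‖) by ring,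
      ← mul_div_assoc, mul_div_mul_left _ _ (by positivity)]
  simp_rw [hpt, integral_const_mul]
  rw [yuk_integral ha z₀]
  field_simp
  norm_num


/-- The explicit double Yukawa-kernel integral used to evaluate the leading
term of the bulk zero-field spin (Pauli) susceptibility:
`∫∫ e^(−a(|z₀−z₁|+|z₁−z₂|+|z₂−z₀|)) / (|z₀−z₁||z₁−z₂||z₂−z₀|) dz₁ dz₂ = 2π²/a³`,
and equivalently, with `a = h⁻¹√(2c)`, the double integral equals
`√π (2π)^(3/2) h³ / (4 c^(3/2))`. -/
theorem spin_green_double_integral :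
    (∀ a : ℝ, 0 < a → ∀ z₀ : EuclideanSpace ℝ (Fin 3),
      (∫ z₁ : EuclideanSpace ℝ (Fin 3), ∫ z₂ : EuclideanSpace ℝ (Fin 3),
          Real.exp (-a * (‖z₀ - z₁‖ + ‖z₁ - z₂‖ + ‖z₂ - z₀‖)) /
            (‖z₀ - z₁‖ * ‖z₁ - z₂‖ * ‖z₂ - z₀‖))
        = 2 * Real.pi ^ 2 / a ^ 3) ∧
    ∀ h c : ℝ, 0 < h → 0 < c → ∀ z₀ : EuclideanSpace ℝ (Fin 3),
      (∫ z₁ : EuclideanSpace ℝ (Fin 3), ∫ z₂ : EuclideanSpace ℝ (Fin 3),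
          Real.exp (-(h⁻¹ * Real.sqrt (2 * c)) * (‖z₀ - z₁‖ + ‖z₁ - z₂‖ + ‖z₂ - z₀‖)) /
            (‖z₀ - z₁‖ * ‖z₁ - z₂‖ * ‖z₂ - z₀‖))
        = Real.sqrt Real.pi * (2 * Real.pi) ^ ((3 : ℝ) / 2) * h ^ 3 /
            (4 * c ^ ((3 : ℝ) / 2)) := by
  refine ⟨spin_green_aux, fun h c hh hc z₀ => ?_⟩
  have hq : 0 < √(2 * c) := by positivity
  rw [spin_green_aux _ (by positivity) z₀]
  have h32 : ∀ x : ℝ, 0 < x → x ^ ((3 : ℝ) / 2) = √x ^ 3 := by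
    intro x hx
    rw [Real.sqrt_eq_rpow, ← Real.rpow_natCast, ← Real.rpow_mul hx.le]; norm_num
  rw [h32 _ hc, h32 _ (by positivity), Real.sqrt_mul (by norm_num), Real.sqrt_mul (by norm_num)]
  have hp : √π ^ 2 = π := Real.sq_sqrt pi_pos.le
  have h2 : √(2 : ℝ) ^ 2 = 2 := Real.sq_sqrt (by norm_num)
  have hp0 : 0 < √π := by positivity
  have hc0 : 0 < √c := by positivity
  have h20 : 0 < √(2 : ℝ) := by positivity
  have h7 : 2 * π ^ 2 = √2 ^ 6 * √π ^ 4 / 4 := by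
    rw [show √(2 : ℝ) ^ 6 = (√2 ^ 2) ^ 3 by ring, show √π ^ 4 = (√π ^ 2) ^ 2 by ring, hp, h2]
    ring
  rw [h7]
  field_simp
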